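/- Let C_a > 0, θ ≥ 0 and let g : 𝕋 → ℝ be continuous; set a := C_a + θg and assume a is even and a(x) > 0 for all x ∈ 𝕋. Let v̄ ∈ ℝ, T > 0, and let (ρ, j) be a classical solution of the reduced Cucker–Smale PDE with kernel a and parameter v̄ on [0,T], satisfying ∫_𝕋 ρ(x,0)dx = 1 and ∫_𝕋 j(x,0)dx = v̄. If 4θ‖g‖‖ρ(·,t)‖ ≤ C_a for all t ∈ [0,T], then ‖j(·,t) − v̄ρ(·,t)‖² ≤ e^{−C_a t} ‖j(·,0) − v̄ρ(·,0)‖² for all t ∈ [0,T]. -/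

import Mathlib

open Real MeasureTheory

/-- Convolution on the torus `ℝ/2πℤ`, with functions represented as `2π`-periodic
functions on `ℝ` and the integral taken over one period. -/
noncomputable def conv1 (f h : ℝ → ℝ) (x : ℝ) : ℝ :=
  ∫ y in (0:ℝ)..(2*π), f (x - y) * h y

/-- `L²(𝕋)` inner product. -/
noncomputable def ip (f h : ℝ → ℝ) : ℝ :=
  ∫ x in (0:ℝ)..(2*π), f x * h x

/-- `L²(𝕋)` norm. -/
noncomputable def nrm (f : ℝ → ℝ) : ℝ := Real.sqrt (ip f f)

/-- A classical solution of the reduced Cucker-Smale PDE with kernel `a` and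
parameter `vbar` on the time interval `I`:  smooth `2π`-periodic-in-`x` functions
`ρ, j` satisfying `∂ₜρ = −∂ₓj` and `∂ₜj = ρ(a∗j) − j(a∗ρ) − vbar²∂ₓρ` pointwise. -/
structure IsClassicalSol (a : ℝ → ℝ) (vbar : ℝ) (ρ j : ℝ → ℝ → ℝ) (I : Set ℝ) : Prop where
  periodic_rho : ∀ t ∈ I, Function.Periodic (fun x => ρ x t) (2*π)
  periodic_j : ∀ t ∈ I, Function.Periodic (fun x => j x t) (2*π)
  smooth_rho : ContDiffOn ℝ (⊤ : ℕ∞) (fun p : ℝ × ℝ => ρ p.1 p.2) (Set.univ ×ˢ I)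
  smooth_j : ContDiffOn ℝ (⊤ : ℕ∞) (fun p : ℝ × ℝ => j p.1 p.2) (Set.univ ×ˢ I)
  pde_rho : ∀ (x : ℝ), ∀ t ∈ I,
    derivWithin (fun s => ρ x s) I t = - deriv (fun y => j y t) x
  pde_j : ∀ (x : ℝ), ∀ t ∈ I,
    derivWithin (fun s => j x s) I t =
      ρ x t * conv1 a (fun y => j y t) x - j x t * conv1 a (fun y => ρ y t) x
        - vbar ^ 2 * deriv (fun y => ρ y t) x


lemma leib (F : ℝ → ℝ → ℝ) (T : ℝ)
    (hF : ContDiffOn ℝ 1 (fun p : ℝ × ℝ => F p.1 p.2) (Set.univ ×ˢ Set.Icc 0 T)) (hT : 0 < T) :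
    ContinuousOn (fun s => ∫ x in (0:ℝ)..(2*π), F x s) (Set.Icc 0 T) ∧
    ∀ t ∈ Set.Ioo (0:ℝ) T, HasDerivAt (fun s => ∫ x in (0:ℝ)..(2*π), F x s)
      (∫ x in (0:ℝ)..(2*π), deriv (fun s => F x s) t) t := by
  have hslice : ∀ t ∈ Set.Icc (0:ℝ) T, Continuous (fun x => F x t) := by
    intro t ht
    have := hF.continuousOn.comp (s := Set.univ) (f := fun x : ℝ => (x, t)) (by fun_prop)
      (fun x _ => ⟨trivial, ht⟩)
    exact continuousOn_univ.mp this
  constructor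
  · have hc : Continuous (Function.uncurry fun (s x : ℝ) =>
        F x (Set.projIcc 0 T hT.le s : ℝ)) := by
      have := hF.continuousOn.comp (s := Set.univ)
        (f := fun p : ℝ × ℝ => (p.2, (Set.projIcc 0 T hT.le p.1 : ℝ)))
        (by
          apply Continuous.continuousOn
          exact continuous_snd.prodMk
            (continuous_subtype_val.comp (continuous_projIcc.comp continuous_fst)))
        (fun x _ => ⟨trivial, Subtype.coe_prop _⟩)
      exact continuousOn_univ.mp this
    have h2 := intervalIntegral.continuous_parametric_intervalIntegral_of_continuous'
      (μ := volume) hc 0 (2*π)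
    refine h2.continuousOn.congr ?_
    intro s hs
    simp only
    rw [Set.projIcc_of_mem hT.le hs]
  · intro t ht
    have hopen : IsOpen ((Set.univ : Set ℝ) ×ˢ Set.Ioo (0:ℝ) T) := isOpen_univ.prod isOpen_Ioo
    have hF1 : ContDiffOn ℝ 1 (fun p : ℝ × ℝ => F p.1 p.2) (Set.univ ×ˢ Set.Ioo 0 T) :=
      hF.mono (Set.prod_mono le_rfl Set.Ioo_subset_Icc_self)
    have hd : ∀ x, ∀ s ∈ Set.Ioo (0:ℝ) T, HasDerivAt (fun s => F x s)
        (fderiv ℝ (fun p : ℝ × ℝ => F p.1 p.2) (x, s) (0, 1)) s := by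
      intro x s hs
      have h1 : DifferentiableAt ℝ (fun p : ℝ × ℝ => F p.1 p.2) (x, s) :=
        (hF1.contDiffAt (hopen.mem_nhds ⟨trivial, hs⟩)).differentiableAt (by simp)
      have h2 : HasDerivAt (fun s : ℝ => (x, s)) ((0:ℝ), (1:ℝ)) s :=
        (hasDerivAt_const s x).prodMk (hasDerivAt_id s)
      exact h1.hasFDerivAt.comp_hasDerivAt s h2
    have hcont : ContinuousOn (fun p : ℝ × ℝ =>
        fderiv ℝ (fun p : ℝ × ℝ => F p.1 p.2) p (0, 1)) (Set.univ ×ˢ Set.Ioo 0 T) := by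
      have := hF1.continuousOn_fderiv_of_isOpen hopen le_rfl
      exact this.clm_apply continuousOn_const
    obtain ⟨c, hc, hct⟩ : ∃ c, c < t ∧ 0 < c := ⟨t/2, by linarith [ht.1], by linarith [ht.1]⟩
    obtain ⟨d, hd1, hd2⟩ : ∃ d, t < d ∧ d < T :=
      ⟨(t+T)/2, by linarith [ht.2], by linarith [ht.2]⟩
    have hsub : Set.Icc c d ⊆ Set.Ioo 0 T :=
      fun s hs => ⟨by linarith [hs.1], by linarith [hs.2]⟩
    obtain ⟨B, hB⟩ := (isCompact_Icc.prod isCompact_Icc :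
      IsCompact (Set.Icc (0:ℝ) (2*π) ×ˢ Set.Icc c d)).exists_bound_of_continuousOn
      (hcont.mono (Set.prod_mono (Set.subset_univ _) hsub))
    have hpi : (0:ℝ) ≤ 2*π := by positivity
    have key := (intervalIntegral.hasDerivAt_integral_of_dominated_loc_of_deriv_le
      (μ := volume) (a := 0) (b := 2*π)
      (F := fun s x => F x s) (F' := fun s x =>
        fderiv ℝ (fun p : ℝ × ℝ => F p.1 p.2) (x, s) (0, 1)) (x₀ := t) (s := Set.Icc c d)
      (bound := fun _ => B) (Icc_mem_nhds hc hd1) ?_ ?_ ?_ ?_ ?_ ?_).2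
    · refine key.congr_deriv ?_
      congr 1
      ext x
      exact (hd x t ht).deriv.symm
    · filter_upwards [Icc_mem_nhds hc hd1] with s hs
      exact (hslice s (Set.Ioo_subset_Icc_self (hsub hs))).aestronglyMeasurable
    · exact (hslice t (Set.Ioo_subset_Icc_self ht)).intervalIntegrable _ _
    · have := hcont.comp (s := Set.univ) (f := fun x : ℝ => (x, t)) (by fun_prop)
        (fun x _ => ⟨trivial, ht⟩)
      exact (continuousOn_univ.mp this).aestronglyMeasurable
    · refine Filter.Eventually.of_forall fun x hx s hs => ?_
      rw [Set.uIoc_of_le hpi] at hx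
      exact hB (x, s) ⟨Set.Ioc_subset_Icc_self hx, hs⟩
    · exact intervalIntegrable_const
    · exact Filter.Eventually.of_forall fun x hx s hs => hd x s (hsub hs)

lemma const_of (M : ℝ → ℝ) (T : ℝ) (hc : ContinuousOn M (Set.Icc 0 T))
    (hd : ∀ t ∈ Set.Ioo (0:ℝ) T, HasDerivAt M 0 t) : ∀ t ∈ Set.Icc (0:ℝ) T, M t = M 0 := by
  intro t ht
  have h0 : (0:ℝ) ∈ Set.Icc 0 T := ⟨le_rfl, ht.1.trans ht.2⟩
  have hdiff : DifferentiableOn ℝ M (interior (Set.Icc 0 T)) := by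
    rw [interior_Icc]
    exact fun s hs => (hd s hs).differentiableAt.differentiableWithinAt
  apply le_antisymm
  · refine antitoneOn_of_deriv_nonpos (convex_Icc 0 T) hc hdiff ?_ h0 ht ht.1
    rw [interior_Icc]
    exact fun s hs => (hd s hs).deriv.le
  · refine monotoneOn_of_deriv_nonneg (convex_Icc 0 T) hc hdiff ?_ h0 ht ht.1
    rw [interior_Icc]
    exact fun s hs => (hd s hs).deriv.ge

lemma ip_self_nonneg (f : ℝ → ℝ) : 0 ≤ ip f f :=
  intervalIntegral.integral_nonneg (by positivity) fun x _ => mul_self_nonneg _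

lemma nrm_sq (f : ℝ → ℝ) : nrm f ^ 2 = ip f f := Real.sq_sqrt (ip_self_nonneg f)

lemma nrm_nonneg (f : ℝ → ℝ) : 0 ≤ nrm f := Real.sqrt_nonneg _

lemma cs (f h : ℝ → ℝ) (hf : Continuous f) (hh : Continuous h) :
    |ip f h| ≤ nrm f * nrm h := by
  have key : ∀ x : ℝ, 0 ≤ ip f f * (x * x) + (2 * ip f h) * x + ip h h := by
    intro x
    have : ip f f * (x * x) + (2 * ip f h) * x + ip h h
        = ip (fun y => x * f y + h y) (fun y => x * f y + h y) := by
      unfold ip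
      rw [← intervalIntegral.integral_mul_const, ← intervalIntegral.integral_const_mul,
        ← intervalIntegral.integral_mul_const, ← intervalIntegral.integral_add,
        ← intervalIntegral.integral_add]
      · congr 1
        ext y
        ring
      all_goals exact Continuous.intervalIntegrable (by fun_prop) _ _
    rw [this]
    exact ip_self_nonneg _
  have hd := discrim_le_zero key
  unfold discrim at hd
  refine abs_le_of_sq_le_sq ?_ (mul_nonneg (nrm_nonneg f) (nrm_nonneg h))
  rw [mul_pow, nrm_sq, nrm_sq]
  linarith

lemma conv_cont (f h : ℝ → ℝ) (hf : Continuous f) (hh : Continuous h) :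
    Continuous (conv1 f h) := by
  unfold conv1
  apply intervalIntegral.continuous_parametric_intervalIntegral_of_continuous'
  unfold Function.uncurry
  fun_prop

lemma conv_bound (g h : ℝ → ℝ) (hg : Continuous g) (hper : Function.Periodic g (2*π))
    (hh : Continuous h) (x : ℝ) : |conv1 g h x| ≤ nrm g * nrm h := by
  have h1 := cs (fun y => g (x - y)) h (by fun_prop) hh
  have h2 : nrm (fun y => g (x - y)) = nrm g := by
    unfold nrm ip
    congr 1
    rw [intervalIntegral.integral_comp_sub_left (fun y => g y * g y) x]
    have hp : Function.Periodic (fun y => g y * g y) (2*π) := hper.mul hper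
    have := hp.intervalIntegral_add_eq (x - 2*π) 0
    simpa using this
  rw [h2] at h1
  exact h1

lemma conv_symm (a f h : ℝ → ℝ) (ha : Continuous a) (hev : ∀ x, a (-x) = a x)
    (hf : Continuous f) (hh : Continuous h) :
    ip f (conv1 a h) = ip h (conv1 a f) := by
  unfold ip conv1
  simp_rw [← intervalIntegral.integral_const_mul]
  rw [intervalIntegral_intervalIntegral_swap]
  · congr 1
    ext y
    congr 1
    ext x
    rw [← hev (x - y), neg_sub]
    ring
  · have hc : Continuous (Function.uncurry fun x y => f x * (a (x - y) * h y)) := by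
      unfold Function.uncurry
      fun_prop
    refine (hc.continuousOn.integrableOn_compact
      ((isCompact_uIcc (a := 0) (b := 2*π)).prod (isCompact_uIcc (a := 0) (b := 2*π)))).mono_set ?_
    exact Set.prod_mono Set.uIoc_subset_uIcc Set.uIoc_subset_uIcc

lemma conv_split (Ca θ : ℝ) (g h : ℝ → ℝ) (hg : Continuous g) (hh : Continuous h) (x : ℝ) :
    conv1 (fun x => Ca + θ * g x) h x
      = Ca * (∫ y in (0:ℝ)..(2*π), h y) + θ * conv1 g h x := by
  unfold conv1
  rw [← intervalIntegral.integral_const_mul, ← intervalIntegral.integral_const_mul,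
        ← intervalIntegral.integral_add]
  · congr 1
    ext y
    ring
  all_goals exact Continuous.intervalIntegrable (by fun_prop) _ _

lemma energy (Ca θ : ℝ) (hθ : 0 ≤ θ) (g r u : ℝ → ℝ) (hg : Continuous g)
    (hper : Function.Periodic g (2*π)) (hr : Continuous r) (hu : Continuous u)
    (hr1 : (∫ x in (0:ℝ)..(2*π), r x) = 1) (hu0 : (∫ x in (0:ℝ)..(2*π), u x) = 0)
    (hs : 4 * θ * nrm g * nrm r ≤ Ca) :
    (∫ x in (0:ℝ)..(2*π), u x * (r x * conv1 (fun x => Ca + θ * g x) u x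
      - u x * conv1 (fun x => Ca + θ * g x) r x)) ≤ - (Ca / 2) * ip u u := by
  have hcu := conv_cont g u hg hu
  have hcr := conv_cont g r hg hr
  have hau : Continuous fun x => |u x| := hu.abs
  have har : Continuous fun x => |r x| := hr.abs
  have habs : ∀ f : ℝ → ℝ, nrm (fun x => |f x|) = nrm f := by
    intro f
    unfold nrm ip
    simp
  have h1 : (∫ x in (0:ℝ)..(2*π), u x * (r x * conv1 (fun x => Ca + θ * g x) u x
      - u x * conv1 (fun x => Ca + θ * g x) r x)) ≤
      ∫ x in (0:ℝ)..(2*π), (θ * (nrm g * nrm u) * (|u x| * |r x|)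
        + (θ * (nrm g * nrm r) - Ca) * (u x * u x)) := by
    apply intervalIntegral.integral_mono_on (by positivity)
    · apply Continuous.intervalIntegrable
      simp_rw [conv_split Ca θ g _ hg hu, conv_split Ca θ g _ hg hr]
      fun_prop
    · exact Continuous.intervalIntegrable (by fun_prop) _ _
    · intro x _
      rw [conv_split Ca θ g _ hg hu, conv_split Ca θ g _ hg hr, hr1, hu0]
      have b1 := conv_bound g u hg hper hu x
      have b2 := conv_bound g r hg hper hr x
      have e1 : u x * r x * conv1 g u x ≤ |u x| * |r x| * (nrm g * nrm u) := by
        refine (le_abs_self _).trans ?_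
        rw [abs_mul, abs_mul]
        gcongr
      have e2 : -(nrm g * nrm r) ≤ conv1 g r x := (abs_le.mp b2).1
      have e3 := mul_le_mul_of_nonneg_left e1 hθ
      have e4 := mul_le_mul_of_nonneg_left e2 (mul_nonneg hθ (mul_self_nonneg (u x)))
      nlinarith [e3, e4]
  refine h1.trans ?_
  rw [intervalIntegral.integral_add, intervalIntegral.integral_const_mul,
    intervalIntegral.integral_const_mul]
  · have h2 : (∫ x in (0:ℝ)..(2*π), |u x| * |r x|) ≤ nrm u * nrm r := by
      have := (le_abs_self _).trans (cs _ _ hau har)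
      rwa [habs, habs] at this
    have h3 : (∫ x in (0:ℝ)..(2*π), u x * u x) = nrm u ^ 2 := (nrm_sq u).symm
    have h4 : ip u u = nrm u ^ 2 := (nrm_sq u).symm
    rw [h3, h4]
    have e3 := mul_le_mul_of_nonneg_left h2
      (mul_nonneg hθ (mul_nonneg (nrm_nonneg g) (nrm_nonneg u)))
    have e4 := mul_le_mul_of_nonneg_right hs (sq_nonneg (nrm u))
    nlinarith [e3, e4]
  all_goals exact Continuous.intervalIntegrable (by fun_prop) _ _

lemma int_deriv_zero (f : ℝ → ℝ) (hf : ContDiff ℝ 1 f) (hp : Function.Periodic f (2*π)) :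
    (∫ x in (0:ℝ)..(2*π), deriv f x) = 0 := by
  rw [intervalIntegral.integral_deriv_eq_sub (fun x _ => (hf.differentiable (by simp)) x)
    ((hf.continuous_deriv le_rfl).intervalIntegrable _ _)]
  have := hp 0
  rw [zero_add] at this
  rw [this, sub_self]

/-- Step II of Proposition `local_result`: conditional flocking estimate as long as
`4θ‖g‖‖ρ(·,t)‖ ≤ C_a` on `[0,T]`. -/
theorem stmt3 (Ca θ : ℝ) (hCa : 0 < Ca) (hθ : 0 ≤ θ)
    (g : ℝ → ℝ) (hg_cont : Continuous g) (hg_per : Function.Periodic g (2*π))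
    (a : ℝ → ℝ) (ha : a = fun x => Ca + θ * g x)
    (ha_even : ∀ x, a (-x) = a x) (ha_pos : ∀ x, 0 < a x)
    (vbar : ℝ) (T : ℝ) (hT : 0 < T)
    (ρ j : ℝ → ℝ → ℝ) (hsol : IsClassicalSol a vbar ρ j (Set.Icc 0 T))
    (hmass_rho : (∫ x in (0:ℝ)..(2*π), ρ x 0) = 1)
    (hmass_j : (∫ x in (0:ℝ)..(2*π), j x 0) = vbar)
    (hsmall : ∀ t ∈ Set.Icc (0:ℝ) T, 4 * θ * nrm g * nrm (fun x => ρ x t) ≤ Ca) :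
    ∀ t ∈ Set.Icc (0:ℝ) T,
      nrm (fun x => j x t - vbar * ρ x t) ^ 2 ≤
        Real.exp (-Ca * t) * nrm (fun x => j x 0 - vbar * ρ x 0) ^ 2 := by
  have hac : Continuous a := by rw [ha]; fun_prop
  have hr1 : ContDiffOn ℝ 1 (fun p : ℝ × ℝ => ρ p.1 p.2) (Set.univ ×ˢ Set.Icc 0 T) :=
    hsol.smooth_rho.of_le (by exact_mod_cast le_top)
  have hj1 : ContDiffOn ℝ 1 (fun p : ℝ × ℝ => j p.1 p.2) (Set.univ ×ˢ Set.Icc 0 T) :=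
    hsol.smooth_j.of_le (by exact_mod_cast le_top)
  have hslice : ∀ F : ℝ → ℝ → ℝ,
      ContDiffOn ℝ 1 (fun p : ℝ × ℝ => F p.1 p.2) (Set.univ ×ˢ Set.Icc 0 T) →
      ∀ t ∈ Set.Icc (0:ℝ) T, ContDiff ℝ 1 (fun x => F x t) := by
    intro F hF t ht
    have := hF.comp (s := Set.univ) (f := fun x : ℝ => (x, t)) (by fun_prop)
      (fun x _ => ⟨trivial, ht⟩)
    exact contDiffOn_univ.mp this
  have hrs := hslice ρ hr1
  have hjs := hslice j hj1
  have hts : ∀ F : ℝ → ℝ → ℝ,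
      ContDiffOn ℝ 1 (fun p : ℝ × ℝ => F p.1 p.2) (Set.univ ×ˢ Set.Icc 0 T) →
      ∀ x, ∀ t ∈ Set.Ioo (0:ℝ) T, HasDerivAt (fun s => F x s)
        (derivWithin (fun s => F x s) (Set.Icc 0 T) t) t := by
    intro F hF x t ht
    have h1 := hF.comp (s := Set.Icc 0 T) (f := fun s : ℝ => (x, s)) (by fun_prop)
      (fun s hs => ⟨trivial, hs⟩)
    have hn : Set.Icc 0 T ∈ nhds t := Icc_mem_nhds ht.1 ht.2
    rw [derivWithin_of_mem_nhds hn]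
    exact ((h1.contDiffAt hn).differentiableAt (by simp)).hasDerivAt
  have hrt : ∀ x, ∀ t ∈ Set.Ioo (0:ℝ) T, HasDerivAt (fun s => ρ x s)
      (- deriv (fun y => j y t) x) t := by
    intro x t ht
    rw [← hsol.pde_rho x t (Set.Ioo_subset_Icc_self ht)]
    exact hts ρ hr1 x t ht
  have hjt : ∀ x, ∀ t ∈ Set.Ioo (0:ℝ) T, HasDerivAt (fun s => j x s)
      (ρ x t * conv1 a (fun y => j y t) x - j x t * conv1 a (fun y => ρ y t) x
        - vbar ^ 2 * deriv (fun y => ρ y t) x) t := by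
    intro x t ht
    rw [← hsol.pde_j x t (Set.Ioo_subset_Icc_self ht)]
    exact hts j hj1 x t ht
  -- conservation of mass
  have hM : ∀ t ∈ Set.Icc (0:ℝ) T, (∫ x in (0:ℝ)..(2*π), ρ x t) = 1 := by
    intro t ht
    rw [← hmass_rho]
    obtain ⟨l1, l2⟩ := leib ρ T hr1 hT
    refine const_of (fun s => ∫ x in (0:ℝ)..(2*π), ρ x s) T l1 ?_ t ht
    intro s hs
    refine (l2 s hs).congr_deriv ?_
    have hs' := Set.Ioo_subset_Icc_self hs
    simp_rw [fun x => (hrt x s hs).deriv]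
    rw [intervalIntegral.integral_neg, int_deriv_zero _ (hjs s hs') (hsol.periodic_j s hs'),
      neg_zero]
  -- conservation of momentum
  have hJ : ∀ t ∈ Set.Icc (0:ℝ) T, (∫ x in (0:ℝ)..(2*π), j x t) = vbar := by
    intro t ht
    rw [← hmass_j]
    obtain ⟨l1, l2⟩ := leib j T hj1 hT
    refine const_of (fun s => ∫ x in (0:ℝ)..(2*π), j x s) T l1 ?_ t ht
    intro s hs
    refine (l2 s hs).congr_deriv ?_
    have hs' := Set.Ioo_subset_Icc_self hs
    simp_rw [fun x => (hjt x s hs).deriv]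
    have c1 := (hrs s hs').continuous
    have c2 := (hjs s hs').continuous
    have c3 := conv_cont a _ hac c1
    have c4 := conv_cont a _ hac c2
    have c5 := (hrs s hs').continuous_deriv le_rfl
    rw [intervalIntegral.integral_sub, intervalIntegral.integral_sub,
      intervalIntegral.integral_const_mul,
      int_deriv_zero _ (hrs s hs') (hsol.periodic_rho s hs')]
    · have := conv_symm a _ _ hac ha_even c1 c2
      unfold ip at this
      rw [this]
      ring
    all_goals exact Continuous.intervalIntegrable (by fun_prop) _ _
  -- energy
  have hu1 : ContDiffOn ℝ 1 (fun p : ℝ × ℝ => j p.1 p.2 - vbar * ρ p.1 p.2)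
      (Set.univ ×ˢ Set.Icc 0 T) := hj1.sub (contDiffOn_const.mul hr1)
  have hE1 := hu1.mul hu1
  obtain ⟨l1, l2⟩ := leib
    (fun x t => (j x t - vbar * ρ x t) * (j x t - vbar * ρ x t)) T hE1 hT
  have hEd : ∀ t ∈ Set.Ioo (0:ℝ) T,
      (∫ x in (0:ℝ)..(2*π), deriv (fun s => (j x s - vbar * ρ x s) * (j x s - vbar * ρ x s)) t)
      ≤ - Ca * ip (fun x => j x t - vbar * ρ x t) (fun x => j x t - vbar * ρ x t) := by
    intro t ht
    have ht' := Set.Ioo_subset_Icc_self ht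
    have c1 := (hrs t ht').continuous
    have c2 := (hjs t ht').continuous
    have hus : ContDiff ℝ 1 (fun x => j x t - vbar * ρ x t) :=
      (hjs t ht').sub (contDiff_const.mul (hrs t ht'))
    have c0 := hus.continuous
    have hu0 : (∫ x in (0:ℝ)..(2*π), (j x t - vbar * ρ x t)) = 0 := by
      rw [intervalIntegral.integral_sub (c2.intervalIntegrable _ _)
        ((c1.const_mul vbar).intervalIntegrable _ _), intervalIntegral.integral_const_mul,
        hM t ht', hJ t ht']
      ring
    have en := energy Ca θ hθ g (fun x => ρ x t) (fun x => j x t - vbar * ρ x t) hg_cont hg_per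
      c1 c0 (hM t ht') hu0 (hsmall t ht')
    rw [← ha] at en
    have hconv : ∀ x, conv1 a (fun y => j y t - vbar * ρ y t) x
        = conv1 a (fun y => j y t) x - vbar * conv1 a (fun y => ρ y t) x := by
      intro x
      unfold conv1
      rw [← intervalIntegral.integral_const_mul, ← intervalIntegral.integral_sub]
      · congr 1
        ext y
        ring
      all_goals exact Continuous.intervalIntegrable (by fun_prop) _ _
    have hpu2 : Function.Periodic
        (fun x => (j x t - vbar * ρ x t) * (j x t - vbar * ρ x t)) (2*π) := by
      intro x
      have e1 := hsol.periodic_j t ht' x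
      have e2 := hsol.periodic_rho t ht' x
      simp only at e1 e2 ⊢
      rw [e1, e2]
    have hz := int_deriv_zero _ (hus.mul hus) hpu2
    have hder : ∀ x, deriv (fun s => (j x s - vbar * ρ x s) * (j x s - vbar * ρ x s)) t
        = 2 * ((j x t - vbar * ρ x t) * (ρ x t * conv1 a (fun y => j y t - vbar * ρ y t) x
          - (j x t - vbar * ρ x t) * conv1 a (fun y => ρ y t) x))
          + vbar * deriv (fun x => (j x t - vbar * ρ x t) * (j x t - vbar * ρ x t)) x := by
      intro x
      have d1 := (hjt x t ht).sub ((hrt x t ht).const_mul vbar)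
      have d2 := d1.mul d1
      have f1 := ((hjs t ht').differentiable (by simp) x).hasDerivAt
      have f2 := ((hrs t ht').differentiable (by simp) x).hasDerivAt
      have f3 := f1.sub (f2.const_mul vbar)
      have f4 := f3.mul f3
      have d3 := d2.deriv
      have f5 := f4.deriv
      simp only [Pi.mul_def, Pi.sub_def] at d3 f5
      rw [d3, f5, hconv]
      ring
    simp_rw [hder]
    have k1 := conv_cont a _ hac c1
    have k2 := conv_cont a _ hac c0
    have k3 := (hus.mul hus).continuous_deriv le_rfl
    rw [intervalIntegral.integral_add, intervalIntegral.integral_const_mul,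
      intervalIntegral.integral_const_mul]
    · have hz' : (∫ x in (0:ℝ)..(2*π),
          deriv (fun x => (j x t - vbar * ρ x t) * (j x t - vbar * ρ x t)) x) = 0 := hz
      rw [hz']
      linarith
    · exact Continuous.intervalIntegrable (by fun_prop) _ _
    · exact Continuous.intervalIntegrable (k3.const_mul vbar) _ _
  intro t ht
  rw [nrm_sq, nrm_sq]
  have hG : AntitoneOn (fun s => Real.exp (Ca * s) *
      ∫ x in (0:ℝ)..(2*π), (j x s - vbar * ρ x s) * (j x s - vbar * ρ x s)) (Set.Icc 0 T) := by
    have hexp : ∀ s, HasDerivAt (fun s => Real.exp (Ca * s)) (Real.exp (Ca * s) * Ca) s := by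
      intro s
      simpa using ((hasDerivAt_id s).const_mul Ca).exp
    have hder := fun s hs => (hexp s).mul (l2 s hs)
    apply antitoneOn_of_deriv_nonpos (convex_Icc 0 T)
    · exact ContinuousOn.mul (by fun_prop) l1
    · rw [interior_Icc]
      exact fun s hs => (hder s hs).differentiableAt.differentiableWithinAt
    · rw [interior_Icc]
      intro s hs
      have h1 := (hder s hs).deriv
      simp only [Pi.mul_def] at h1
      rw [h1]
      have h2 := mul_le_mul_of_nonneg_left (hEd s hs) (Real.exp_pos (Ca * s)).le
      unfold ip at h2
      linarith
  have h := hG ⟨le_rfl, hT.le⟩ ht ht.1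
  simp only [mul_zero, Real.exp_zero, one_mul] at h
  have h3 := mul_le_mul_of_nonneg_left h (Real.exp_pos (-Ca * t)).le
  rw [← mul_assoc, ← Real.exp_add] at h3
  simpa [ip] using h3
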